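/- Let p, q ∈ C₊(ℝ^N×ℝ^N) and let μ : ℝ^N×ℝ^N → ℝ satisfy 0 < μ⁻ ≤ μ⁺ < N together with the relation μ(x,y) = 2N(1 − 1/(2p(x,y)) − 1/(2q(x,y))) for all (x,y) ∈ ℝ^N×ℝ^N. Assume there exist sequences (x_n,y_n) and (x_n′,y_n′) in ℝ^N×ℝ^N such that p(x_n,y_n) → p⁺, q(x_n,y_n) → q⁺ and p(x_n′,y_n′) → p⁻, q(x_n′,y_n′) → q⁻ as n → ∞. Then for all h ∈ L^{p⁺}(ℝ^N) ∩ L^{p⁻}(ℝ^N) and g ∈ L^{q⁺}(ℝ^N) ∩ L^{q⁻}(ℝ^N), |∫_{ℝ^N}∫_{ℝ^N} h(x)g(y)/|x−y|^{μ(x,y)} dx dy| ≤ c₁(‖h‖_{L^{p⁺}(ℝ^N)}‖g‖_{L^{q⁺}(ℝ^N)} + ‖h‖_{L^{p⁻}(ℝ^N)}‖g‖_{L^{q⁻}(ℝ^N)}), where c₁ > 0 is a constant independent of h and g. -/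

import Mathlib

open MeasureTheory Set Filter ENNReal

noncomputable section

namespace VarOrderChoquard

variable {N : ℕ}

/-- `ℝ^N` with the Euclidean structure. -/
abbrev RN (N : ℕ) := EuclideanSpace ℝ (Fin N)

/-- `Φ⁻` : infimum of a two-variable real function over `ℝ^N × ℝ^N`. -/
def inf2 (f : RN N → RN N → ℝ) : ℝ := sInf {t | ∃ x y, f x y = t}

/-- `Φ⁺` : supremum of a two-variable real function over `ℝ^N × ℝ^N`. -/
def sup2 (f : RN N → RN N → ℝ) : ℝ := sSup {t | ∃ x y, f x y = t}

/-- `Φ⁻` over a subset `D ⊆ ℝ^N`. -/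
def infOn (D : Set (RN N)) (g : RN N → ℝ) : ℝ := sInf (g '' D)

/-- `Φ⁺` over a subset `D ⊆ ℝ^N`. -/
def supOn (D : Set (RN N)) (g : RN N → ℝ) : ℝ := sSup (g '' D)

/-- `C₊(ℝ^N × ℝ^N)` : continuous with `1 < Φ⁻ ≤ Φ⁺ < ∞`. -/
def CPlus2 (f : RN N → RN N → ℝ) : Prop :=
  Continuous (fun z : RN N × RN N => f z.1 z.2) ∧ 1 < inf2 f ∧
    BddAbove {t | ∃ x y, f x y = t}

/-- `C₊(D)` for `D ⊆ ℝ^N`. -/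
def CPlusOn (D : Set (RN N)) (g : RN N → ℝ) : Prop :=
  ContinuousOn g D ∧ 1 < infOn D g ∧ BddAbove (g '' D)

/-- Condition (S1). -/
def S1 (s : RN N → RN N → ℝ) : Prop :=
  Continuous (fun z : RN N × RN N => s z.1 z.2) ∧ (∀ x y, s x y = s y x) ∧
    BddAbove {t | ∃ x y, s x y = t} ∧ 0 < inf2 s ∧ sup2 s < 1

/-- Condition (P1). -/
def P1 (s p : RN N → RN N → ℝ) : Prop :=
  CPlus2 p ∧ (∀ x y, p x y = p y x) ∧ sup2 s * sup2 p < N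

/-- Condition (μ1). -/
def Mu1 (μ : RN N → RN N → ℝ) : Prop :=
  (∀ x y, μ x y = μ y x) ∧ BddAbove {t | ∃ x y, μ x y = t} ∧
    0 < inf2 μ ∧ sup2 μ < N

/-- The critical exponent `p_s*(x) = N p(x,x) / (N - s(x,x) p(x,x))`. -/
def pstar (s p : RN N → RN N → ℝ) (x : RN N) : ℝ :=
  N * p x x / (N - s x x * p x x)

/-- The class `𝓜` : `p(x,x) ≤ r(x)q⁻ ≤ r(x)q⁺ < p_s*(x)` for all `x`. -/
def MemM (s p q : RN N → RN N → ℝ) (r : RN N → ℝ) : Prop :=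
  ∀ x, p x x ≤ r x * inf2 q ∧ r x * inf2 q ≤ r x * sup2 q ∧
    r x * sup2 q < pstar s p x

/-- Variable-exponent modular `∫_U |u/l|^{γ(x)} dx`. -/
def lmodular (U : Set (RN N)) (γ : RN N → ℝ) (u : RN N → ℝ) (l : ℝ) : ℝ≥0∞ :=
  ∫⁻ x in U, ENNReal.ofReal (|u x| / l) ^ γ x

/-- Membership in the variable-exponent Lebesgue space `L^{γ(x)}(U)`. -/
def MemVarLp (U : Set (RN N)) (γ : RN N → ℝ) (u : RN N → ℝ) : Prop :=
  Measurable u ∧ ∃ l, 0 < l ∧ lmodular U γ u l < ⊤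

/-- Luxemburg norm on `L^{γ(x)}(U)`. -/
def luxNorm (U : Set (RN N)) (γ : RN N → ℝ) (u : RN N → ℝ) : ℝ :=
  sInf {l | 0 < l ∧ lmodular U γ u l ≤ 1}

/-- Membership in the classical Lebesgue space `L^t(U)` (constant exponent `t`). -/
def MemCLp (U : Set (RN N)) (t : ℝ) (g : RN N → ℝ) : Prop :=
  Measurable g ∧ (∫⁻ x in U, ENNReal.ofReal |g x| ^ t) < ⊤

/-- The classical `L^t(U)`-norm. -/
def cLpNorm (U : Set (RN N)) (t : ℝ) (g : RN N → ℝ) : ℝ :=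
  (∫⁻ x in U, ENNReal.ofReal |g x| ^ t).toReal ^ (1 / t)

/-- Gagliardo-type modular
`∫_A (|u(x)-u(y)|/l)^{p(x,y)} / |x-y|^{N+s(x,y)p(x,y)} dx dy`. -/
def gmodular (A : Set (RN N × RN N)) (s p : RN N → RN N → ℝ) (u : RN N → ℝ)
    (l : ℝ) : ℝ≥0∞ :=
  ∫⁻ z in A, ENNReal.ofReal (|u z.1 - u z.2| / l) ^ p z.1 z.2 /
    ENNReal.ofReal (dist z.1 z.2) ^ ((N : ℝ) + s z.1 z.2 * p z.1 z.2)

/-- Membership in `W^{s(x,y),β(x),p(x,y)}(U)`. -/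
def MemW (U : Set (RN N)) (s p : RN N → RN N → ℝ) (β : RN N → ℝ)
    (u : RN N → ℝ) : Prop :=
  MemVarLp U β u ∧ ∃ l, 0 < l ∧ gmodular (U ×ˢ U) s p u l < ⊤

/-- The Gagliardo seminorm `[u]_U^{s,p}`. -/
def wSeminorm (U : Set (RN N)) (s p : RN N → RN N → ℝ) (u : RN N → ℝ) : ℝ :=
  sInf {l | 0 < l ∧ gmodular (U ×ˢ U) s p u l < 1}

/-- The norm on `W`. -/
def wNorm (U : Set (RN N)) (s p : RN N → RN N → ℝ) (β : RN N → ℝ)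
    (u : RN N → ℝ) : ℝ :=
  luxNorm U β u + wSeminorm U s p u

/-- `Q = (ℝ^N × ℝ^N) \ (Ωᶜ × Ωᶜ)`. -/
def Qset (Ω : Set (RN N)) : Set (RN N × RN N) := univ \ (Ωᶜ ×ˢ Ωᶜ)

/-- Membership in `X₀`. -/
def MemX0 (Ω : Set (RN N)) (s p : RN N → RN N → ℝ) (β : RN N → ℝ)
    (u : RN N → ℝ) : Prop :=
  Measurable u ∧ MemVarLp Ω β u ∧ (∃ l, 0 < l ∧ gmodular (Qset Ω) s p u l < ⊤) ∧
    (∀ᵐ x, x ∉ Ω → u x = 0)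

/-- The `X₀`-norm. -/
def x0Norm (s p : RN N → RN N → ℝ) (u : RN N → ℝ) : ℝ :=
  sInf {l | 0 < l ∧ gmodular univ s p u l < 1}

/-- The modular `ρ_{X₀}`. -/
def rhoX0 (s p : RN N → RN N → ℝ) (u : RN N → ℝ) : ℝ≥0∞ :=
  gmodular univ s p u 1

/-- Carathéodory function. -/
def Caratheodory (f : RN N → ℝ → ℝ) : Prop :=
  (∀ t, Measurable fun x => f x t) ∧ ∀ x, Continuous fun t => f x t

/-- `F(x,t) = ∫₀ᵗ f(x,τ) dτ`. -/
def Fant (f : RN N → ℝ → ℝ) (x : RN N) (t : ℝ) : ℝ := ∫ τ in (0:ℝ)..t, f x τ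

/-- Growth condition (F1) (with data `M` and `r`). -/
def F1 (Ω : Set (RN N)) (f : RN N → ℝ → ℝ) (M : ℝ) (r : RN N → ℝ) : Prop :=
  0 < M ∧ ∀ x ∈ Ω, ∀ t : ℝ, |f x t| ≤ M * |t| ^ (r x - 1)

/-- Ambrosetti–Rabinowitz type condition (F2) (with data `Θ`). -/
def F2 (Ω : Set (RN N)) (f : RN N → ℝ → ℝ) (Θ : ℝ) : Prop :=
  ∀ᵐ x, x ∈ Ω → ∀ t : ℝ, t ≠ 0 →
    0 < Θ * Fant f x t ∧ Θ * Fant f x t ≤ 2 * (t * f x t)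

/-- The left-hand side pairing
`∫∫ |u(x)-u(y)|^{p-2}(u(x)-u(y))(w(x)-w(y)) / |x-y|^{N+sp} dx dy`. -/
def energyLHS (s p : RN N → RN N → ℝ) (u w : RN N → ℝ) : ℝ :=
  ∫ z : RN N × RN N,
    |u z.1 - u z.2| ^ (p z.1 z.2 - 2) * (u z.1 - u z.2) * (w z.1 - w z.2) /
      dist z.1 z.2 ^ ((N : ℝ) + s z.1 z.2 * p z.1 z.2)

/-- The Choquard right-hand side `∫_Ω ∫_Ω F(x,u(x)) f(y,u(y)) w(y) / |x-y|^μ`. -/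
def choquardRHS (Ω : Set (RN N)) (μ : RN N → RN N → ℝ) (f : RN N → ℝ → ℝ)
    (u w : RN N → ℝ) : ℝ :=
  ∫ x in Ω, ∫ y in Ω, Fant f x (u x) * f y (u y) * w y / dist x y ^ μ x y

/-- The energy functional `J`. -/
def Jfun (Ω : Set (RN N)) (s p μ : RN N → RN N → ℝ) (f : RN N → ℝ → ℝ)
    (u : RN N → ℝ) : ℝ :=
  (∫ z : RN N × RN N,
    |u z.1 - u z.2| ^ p z.1 z.2 /
      (p z.1 z.2 * dist z.1 z.2 ^ ((N : ℝ) + s z.1 z.2 * p z.1 z.2)))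
  - (1/2) * ∫ x in Ω, ∫ y in Ω,
      Fant f x (u x) * Fant f y (u y) / dist x y ^ μ x y

/-- `⟨J'(u), w⟩`. -/
def Jderiv (Ω : Set (RN N)) (s p μ : RN N → RN N → ℝ) (f : RN N → ℝ → ℝ)
    (u w : RN N → ℝ) : ℝ :=
  energyLHS s p u w - choquardRHS Ω μ f u w

/-- The perturbed functional `J_λ`. -/
def Jlam (Ω : Set (RN N)) (s p μ : RN N → RN N → ℝ) (f : RN N → ℝ → ℝ)
    (α : RN N → ℝ) (lam : ℝ) (u : RN N → ℝ) : ℝ :=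
  Jfun Ω s p μ f u - lam * ∫ x in Ω, |u x| ^ α x / α x


section RieszKernel

variable {E : Type*} [NormedAddCommGroup E] [NormedSpace ℝ E] [FiniteDimensional ℝ E]
  [Nontrivial E] [MeasurableSpace E] [BorelSpace E] (ν : Measure E) [ν.IsAddHaarMeasure]

open Module (finrank)

lemma lintegral_indicator_norm_rpow {S : Set ℝ} (hS : MeasurableSet S) (hS0 : S ⊆ Ioi 0) (s : ℝ)
    (hint : IntegrableOn (fun r : ℝ => r ^ ((finrank ℝ E : ℝ) - 1 - s)) S) :
    ∫⁻ y : E, S.indicator (fun r => ENNReal.ofReal (r ^ (-s))) ‖y‖ ∂ν =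
      ENNReal.ofReal (finrank ℝ E * ν.real (Metric.ball 0 1) *
        ∫ r in S, r ^ ((finrank ℝ E : ℝ) - 1 - s)) := by
  have hd : 1 ≤ finrank ℝ E := Module.finrank_pos
  have hmul : ∀ r ∈ Ioi (0 : ℝ), r ^ (finrank ℝ E - 1) • S.indicator (fun r => r ^ (-s)) r =
      S.indicator (fun r : ℝ => r ^ ((finrank ℝ E : ℝ) - 1 - s)) r := by
    intro r hr
    by_cases hrS : r ∈ S
    · rw [indicator_of_mem hrS, indicator_of_mem hrS, smul_eq_mul, ← Real.rpow_natCast,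
        ← Real.rpow_add hr, Nat.cast_sub hd, Nat.cast_one, sub_eq_add_neg (_ - _)]
    · simp [hrS]
  have hi : Integrable (fun y : E => S.indicator (fun r => r ^ (-s)) ‖y‖) ν := by
    rw [integrable_fun_norm_addHaar ν, integrableOn_congr_fun hmul measurableSet_Ioi]
    exact (hint.integrable_indicator hS).integrableOn
  have hnn : ∀ r : ℝ, 0 ≤ S.indicator (fun r => r ^ (-s)) r := fun r =>
    indicator_nonneg (fun r hr => Real.rpow_nonneg (hS0 hr).le _) r
  have hval : ∫ y : E, S.indicator (fun r => r ^ (-s)) ‖y‖ ∂ν =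
      finrank ℝ E * ν.real (Metric.ball 0 1) * ∫ r in S, r ^ ((finrank ℝ E : ℝ) - 1 - s) := by
    rw [integral_fun_norm_addHaar ν, setIntegral_congr_fun measurableSet_Ioi hmul,
      setIntegral_indicator hS, inter_eq_right.2 hS0, nsmul_eq_mul, smul_eq_mul, mul_assoc]
  rw [← hval, ofReal_integral_eq_lintegral_ofReal hi (ae_of_all _ fun y => hnn _)]
  refine lintegral_congr fun y => ?_
  by_cases hy : ‖y‖ ∈ S <;> simp [hy]

lemma exists_lintegral_Ioc_norm_rpow_le {s : ℝ} (hs : s < finrank ℝ E) :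
    ∃ C : NNReal, ∀ R : ℝ, 0 < R →
      ∫⁻ y : E, (Ioc 0 R).indicator (fun r => ENNReal.ofReal (r ^ (-s))) ‖y‖ ∂ν ≤
        C * ENNReal.ofReal (R ^ ((finrank ℝ E : ℝ) - s)) := by
  refine ⟨(finrank ℝ E * ν.real (Metric.ball 0 1) * (finrank ℝ E - s)⁻¹).toNNReal, fun R hR => ?_⟩
  have hs' : (-1 : ℝ) < finrank ℝ E - 1 - s := by linarith
  have hint := (intervalIntegrable_iff_integrableOn_Ioc_of_le hR.le).1
    (intervalIntegral.intervalIntegrable_rpow' (a := 0) (b := R) hs')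
  rw [lintegral_indicator_norm_rpow ν measurableSet_Ioc Ioc_subset_Ioi_self s hint,
    ← intervalIntegral.integral_of_le hR.le, integral_rpow (Or.inl hs')]
  have h1 : (finrank ℝ E : ℝ) - 1 - s + 1 = finrank ℝ E - s := by ring
  rw [h1, Real.zero_rpow (by linarith), sub_zero, ← ENNReal.ofReal.eq_1 (_ * _),
    ← ENNReal.ofReal_mul (mul_nonneg (by positivity) (inv_nonneg.2 (by linarith)))]
  apply le_of_eq
  congr 1
  ring

lemma exists_lintegral_Ioi_norm_rpow_le {s : ℝ} (hs : finrank ℝ E < s) :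
    ∃ C : NNReal, ∀ R : ℝ, 0 < R →
      ∫⁻ y : E, (Ioi R).indicator (fun r => ENNReal.ofReal (r ^ (-s))) ‖y‖ ∂ν ≤
        C * ENNReal.ofReal (R ^ ((finrank ℝ E : ℝ) - s)) := by
  refine ⟨(finrank ℝ E * ν.real (Metric.ball 0 1) * (s - finrank ℝ E)⁻¹).toNNReal, fun R hR => ?_⟩
  have hs' : finrank ℝ E - 1 - s < (-1 : ℝ) := by linarith
  rw [lintegral_indicator_norm_rpow ν measurableSet_Ioi (Ioi_subset_Ioi hR.le) s
    (integrableOn_Ioi_rpow_of_lt hs' hR), integral_Ioi_rpow_of_lt hs' hR]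
  have h1 : (finrank ℝ E : ℝ) - 1 - s + 1 = finrank ℝ E - s := by ring
  rw [h1, ← ENNReal.ofReal.eq_1 (_ * _),
    ← ENNReal.ofReal_mul (mul_nonneg (by positivity) (inv_nonneg.2 (by linarith)))]
  apply le_of_eq
  congr 1
  rw [← neg_sub (finrank ℝ E : ℝ) s, inv_neg]
  ring

/-- A bounded truncation of a function in the unit ball of `L^q` has a Riesz potential controlled
by a power of the truncation radius. -/
lemma exists_lintegral_min_mul_norm_rpow_le {q lam : ℝ} (hq : 1 < q)
    (hlam : lam < finrank ℝ E) (hqlam : finrank ℝ E * (1 - 1 / q) < lam) :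
    ∃ C : NNReal, ∀ G : E → ℝ≥0∞, Measurable G → ∫⁻ y, G y ^ q ∂ν ≤ 1 → ∀ R : ℝ, 0 < R → ∀ x : E,
      ∫⁻ y, min (G y) (ENNReal.ofReal (R ^ (-(finrank ℝ E / q)))) *
          ENNReal.ofReal (‖x - y‖ ^ (-lam)) ∂ν ≤
        C * ENNReal.ofReal (R ^ (finrank ℝ E - finrank ℝ E / q - lam)) := by
  set d := (finrank ℝ E : ℝ)
  have hd0 : 0 < d := Nat.cast_pos.2 Module.finrank_pos
  have hqq := Real.HolderConjugate.conjExponent hq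
  set q' := q.conjExponent
  have hq' : 1 - 1 / q = 1 / q' := by
    have := hqq.inv_add_inv_eq_one
    rw [one_div, one_div]; linarith
  have hq'0 : 0 < q' := hqq.symm.pos
  have hlam0 : 0 < lam := by
    rw [hq'] at hqlam
    exact lt_trans (by positivity) hqlam
  have hs : d < lam * q' := by
    rw [hq', mul_one_div, div_lt_iff₀ hq'0] at hqlam
    exact hqlam
  obtain ⟨C₁, hC₁⟩ := exists_lintegral_Ioc_norm_rpow_le ν hlam
  obtain ⟨C₂, hC₂⟩ := exists_lintegral_Ioi_norm_rpow_le ν hs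
  refine ⟨C₁ + C₂ ^ (1 / q'), fun G hG hGq R hR x => ?_⟩
  set M := ENNReal.ofReal (R ^ (-(d / q))) with hM
  let k : ℝ → ℝ≥0∞ := fun r => ENNReal.ofReal (r ^ (-lam))
  have hk : Measurable k := by fun_prop
  have hknorm : ∀ {S : Set ℝ}, MeasurableSet S → Measurable fun y => S.indicator k ‖x - y‖ :=
    fun hS => (hk.indicator hS).comp (measurable_const.sub measurable_id).norm
  have hsplit : ∀ y, min (G y) M * ENNReal.ofReal (‖x - y‖ ^ (-lam)) ≤
      M * (Ioc 0 R).indicator k ‖x - y‖ + G y * (Ioi R).indicator k ‖x - y‖ := by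
    intro y
    rcases (norm_nonneg (x - y)).eq_or_lt with h0 | h0
    · rw [← h0, Real.zero_rpow (by linarith)]
      simp
    rcases le_or_gt ‖x - y‖ R with hle | hgt
    · rw [indicator_of_mem (show ‖x - y‖ ∈ Ioc 0 R from ⟨h0, hle⟩)]
      exact le_add_right (by gcongr; exact min_le_right _ _)
    · rw [indicator_of_mem (show ‖x - y‖ ∈ Ioi R from hgt)]
      exact le_add_left (by gcongr; exact min_le_left _ _)
  have hnear : ∫⁻ y, M * (Ioc 0 R).indicator k ‖x - y‖ ∂ν ≤
      C₁ * ENNReal.ofReal (R ^ (d - d / q - lam)) := by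
    rw [lintegral_const_mul _ (hknorm measurableSet_Ioc),
      lintegral_sub_left_eq_self (fun y => (Ioc 0 R).indicator k ‖y‖) x]
    calc M * _ ≤ M * (C₁ * ENNReal.ofReal (R ^ (d - lam))) := by gcongr; exact hC₁ R hR
      _ = C₁ * ENNReal.ofReal (R ^ (d - d / q - lam)) := by
        rw [mul_left_comm, hM, ← ENNReal.ofReal_mul (by positivity), ← Real.rpow_add hR]
        ring_nf
  have hfar : ∫⁻ y, G y * (Ioi R).indicator k ‖x - y‖ ∂ν ≤
      (C₂ ^ (1 / q') : NNReal) * ENNReal.ofReal (R ^ (d - d / q - lam)) := by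
    have hpow : ∀ r, (Ioi R).indicator k r ^ q' =
        (Ioi R).indicator (fun r => ENNReal.ofReal (r ^ (-(lam * q')))) r := by
      intro r
      by_cases hr : r ∈ Ioi R
      · have hr0 : 0 < r := hR.trans hr
        simp only [indicator_of_mem hr, k]
        rw [ENNReal.ofReal_rpow_of_pos (by positivity), ← Real.rpow_mul hr0.le, neg_mul]
      · simp [hr, hq'0]
    have hkint : ∫⁻ y, ((Ioi R).indicator k ‖x - y‖) ^ q' ∂ν ≤
        C₂ * ENNReal.ofReal (R ^ (d - lam * q')) := by
      rw [lintegral_sub_left_eq_self (fun y => ((Ioi R).indicator k ‖y‖) ^ q') x]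
      simp_rw [hpow]
      exact hC₂ R hR
    calc _ ≤ (∫⁻ y, G y ^ q ∂ν) ^ (1 / q) *
          (∫⁻ y, ((Ioi R).indicator k ‖x - y‖) ^ q' ∂ν) ^ (1 / q') :=
        ENNReal.lintegral_mul_le_Lp_mul_Lq ν hqq hG.aemeasurable
          (hknorm measurableSet_Ioi).aemeasurable
      _ ≤ 1 ^ (1 / q) * (C₂ * ENNReal.ofReal (R ^ (d - lam * q'))) ^ (1 / q') := by
        gcongr
      _ = _ := by
        rw [ENNReal.one_rpow, one_mul, ENNReal.mul_rpow_of_nonneg _ _ (by positivity),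
          ENNReal.coe_rpow_of_nonneg _ (by positivity),
          ENNReal.ofReal_rpow_of_pos (by positivity), ← Real.rpow_mul hR.le]
        congr 3
        have : d - d / q = d / q' := by
          rw [← mul_one_div d q, ← mul_one_div d q', ← hq']; ring
        rw [this]
        field_simp
  calc _ ≤ ∫⁻ y, (M * (Ioc 0 R).indicator k ‖x - y‖ + G y * (Ioi R).indicator k ‖x - y‖) ∂ν :=
      lintegral_mono hsplit
    _ = ∫⁻ y, M * (Ioc 0 R).indicator k ‖x - y‖ ∂ν +
        ∫⁻ y, G y * (Ioi R).indicator k ‖x - y‖ ∂ν :=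
      lintegral_add_left ((hknorm measurableSet_Ioc).const_mul M) _
    _ ≤ _ := by
      rw [ENNReal.coe_add, add_mul]
      gcongr

/-- In the scaling-critical case the truncation level `t ^ (p / q)` yields the bound
`t ^ (p - 1)`. -/
lemma exists_lintegral_min_rpow_mul_norm_rpow_le {p q lam : ℝ} (hp : 1 < p) (hq : 1 < q)
    (hlam : lam < finrank ℝ E) (hpq : 1 / p + 1 / q + lam / finrank ℝ E = 2) :
    ∃ C : NNReal, ∀ G : E → ℝ≥0∞, Measurable G → ∫⁻ y, G y ^ q ∂ν ≤ 1 →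
      ∀ t : ℝ≥0∞, t ≠ ∞ → ∀ x : E,
        ∫⁻ y, min (G y) (t ^ (p / q)) * ENNReal.ofReal (‖x - y‖ ^ (-lam)) ∂ν ≤ C * t ^ (p - 1) := by
  have hd0 : (0 : ℝ) < finrank ℝ E := Nat.cast_pos.2 Module.finrank_pos
  have hp0 : 0 < p := by linarith
  have hq0 : 0 < q := by linarith
  have hlameq : lam = finrank ℝ E * (2 - 1 / p - 1 / q) := by
    rw [← hpq]; field_simp; ring
  have hp1 : 1 / p < 1 := by rw [div_lt_one hp0]; exact hp
  obtain ⟨C, hC⟩ := exists_lintegral_min_mul_norm_rpow_le ν (q := q) hq hlam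
    (by rw [hlameq]; gcongr; linarith)
  refine ⟨C, fun G hG hGq t ht x => ?_⟩
  rcases eq_or_ne t 0 with rfl | ht0
  · simp [ENNReal.zero_rpow_of_pos (div_pos hp0 hq0)]
  lift t to NNReal using ht
  have ht0 : 0 < (t : ℝ) := by
    have : t ≠ 0 := by simpa using ht0
    positivity
  have key := hC G hG hGq ((t : ℝ) ^ (-(p / finrank ℝ E))) (by positivity) x
  have h1 : -(p / finrank ℝ E) * -(finrank ℝ E / q) = p / q := by field_simp
  have h2 : -(p / finrank ℝ E) * (finrank ℝ E - finrank ℝ E / q - lam) = p - 1 := by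
    rw [hlameq]; field_simp; ring
  rwa [← Real.rpow_mul ht0.le, ← Real.rpow_mul ht0.le, h1, h2,
    ← ENNReal.ofReal_rpow_of_pos ht0, ← ENNReal.ofReal_rpow_of_pos ht0,
    ENNReal.ofReal_coe_nnreal] at key

lemma exists_lintegral_lintegral_mul_norm_rpow_le_of_le_one {p q lam : ℝ} (hp : 1 < p) (hq : 1 < q)
    (hlam : lam < finrank ℝ E) (hpq : 1 / p + 1 / q + lam / finrank ℝ E = 2) :
    ∃ C : NNReal, ∀ F G : E → ℝ≥0∞, Measurable F → Measurable G →
      (∀ x, F x ≠ ∞) → (∀ y, G y ≠ ∞) → ∫⁻ x, F x ^ p ∂ν ≤ 1 → ∫⁻ y, G y ^ q ∂ν ≤ 1 →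
        ∫⁻ x, ∫⁻ y, F x * G y * ENNReal.ofReal (‖x - y‖ ^ (-lam)) ∂ν ∂ν ≤ C := by
  have hp0 : 0 < p := by linarith
  have hq0 : 0 < q := by linarith
  obtain ⟨C₁, hC₁⟩ := exists_lintegral_min_rpow_mul_norm_rpow_le ν hp hq hlam hpq
  obtain ⟨C₂, hC₂⟩ := exists_lintegral_min_rpow_mul_norm_rpow_le ν hq hp hlam
    (by rw [← hpq]; ring)
  refine ⟨C₁ + C₂, fun F G hF hG hFt hGt hFp hGq => ?_⟩
  let k : E → E → ℝ≥0∞ := fun x y => ENNReal.ofReal (‖x - y‖ ^ (-lam))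
  have hk : Measurable (Function.uncurry k) := by
    unfold k Function.uncurry
    fun_prop
  have hmul : ∀ (t : ℝ≥0∞) {r : ℝ}, 1 < r → t * t ^ (r - 1) = t ^ r := by
    intro t r hr
    conv_lhs => rw [← ENNReal.rpow_one t, ← ENNReal.rpow_mul, one_mul,
      ← ENNReal.rpow_add_of_nonneg _ _ zero_le_one (by linarith), add_sub_cancel]
  have hsplit : ∀ x y, F x * G y * k x y ≤
      F x * (min (G y) (F x ^ (p / q)) * k x y) + G y * (min (F x) (G y ^ (q / p)) * k x y) := by
    intro x y
    rcases le_or_gt (G y) (F x ^ (p / q)) with h | h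
    · rw [min_eq_left h, mul_assoc]
      exact le_self_add
    · have h' : F x ≤ G y ^ (q / p) := by
        have := ENNReal.rpow_le_rpow h.le (div_pos hq0 hp0).le
        rwa [← ENNReal.rpow_mul, show p / q * (q / p) = 1 by field_simp, ENNReal.rpow_one] at this
      rw [min_eq_left h', mul_comm (F x) (G y), mul_assoc]
      exact le_add_self
  have hfirst : ∫⁻ x, ∫⁻ y, F x * (min (G y) (F x ^ (p / q)) * k x y) ∂ν ∂ν ≤ C₁ := by
    calc _ ≤ ∫⁻ x, C₁ * F x ^ p ∂ν := by
          refine lintegral_mono fun x => ?_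
          rw [lintegral_const_mul' _ _ (hFt x), ← hmul (F x) hp, mul_left_comm]
          gcongr
          exact hC₁ G hG hGq (F x) (hFt x) x
      _ ≤ C₁ := by
          rw [lintegral_const_mul' _ _ ENNReal.coe_ne_top]
          exact mul_le_of_le_one_right' hFp
  have hsecond : ∫⁻ y, ∫⁻ x, G y * (min (F x) (G y ^ (q / p)) * k x y) ∂ν ∂ν ≤ C₂ := by
    calc _ ≤ ∫⁻ y, C₂ * G y ^ q ∂ν := by
          refine lintegral_mono fun y => ?_
          rw [lintegral_const_mul' _ _ (hGt y), ← hmul (G y) hq, mul_left_comm]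
          gcongr
          simp_rw [k, norm_sub_rev _ y]
          exact hC₂ F hF hFp (G y) (hGt y) y
      _ ≤ C₂ := by
          rw [lintegral_const_mul' _ _ ENNReal.coe_ne_top]
          exact mul_le_of_le_one_right' hGq
  have hm₁ : Measurable (Function.uncurry fun x y =>
      F x * (min (G y) (F x ^ (p / q)) * k x y)) := by
    unfold k Function.uncurry
    fun_prop
  have hm₂ : Measurable (Function.uncurry fun x y =>
      G y * (min (F x) (G y ^ (q / p)) * k x y)) := by
    unfold k Function.uncurry
    fun_prop
  calc _ ≤ ∫⁻ x, ∫⁻ y, (F x * (min (G y) (F x ^ (p / q)) * k x y) +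
        G y * (min (F x) (G y ^ (q / p)) * k x y)) ∂ν ∂ν :=
      lintegral_mono fun x => lintegral_mono (hsplit x)
    _ = (∫⁻ x, ∫⁻ y, F x * (min (G y) (F x ^ (p / q)) * k x y) ∂ν ∂ν) +
        ∫⁻ x, ∫⁻ y, G y * (min (F x) (G y ^ (q / p)) * k x y) ∂ν ∂ν := by
      rw [← lintegral_add_left hm₁.lintegral_prod_right]
      refine lintegral_congr fun x => ?_
      exact lintegral_add_left (hm₁.comp measurable_prodMk_left) _
    _ ≤ C₁ + C₂ := by
      gcongr
      rw [lintegral_lintegral_swap hm₂.aemeasurable]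
      exact hsecond
    _ = _ := by simp

/-- The **Hardy–Littlewood–Sobolev inequality** on a finite-dimensional real normed space. -/
theorem exists_lintegral_lintegral_mul_norm_rpow_le {p q lam : ℝ} (hp : 1 < p) (hq : 1 < q)
    (hlam : lam < finrank ℝ E) (hpq : 1 / p + 1 / q + lam / finrank ℝ E = 2) :
    ∃ C : NNReal, ∀ F G : E → ℝ≥0∞, Measurable F → Measurable G →
      (∀ x, F x ≠ ∞) → (∀ y, G y ≠ ∞) → ∫⁻ x, F x ^ p ∂ν ≠ ∞ → ∫⁻ y, G y ^ q ∂ν ≠ ∞ →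
        ∫⁻ x, ∫⁻ y, F x * G y * ENNReal.ofReal (‖x - y‖ ^ (-lam)) ∂ν ∂ν ≤
          C * ((∫⁻ x, F x ^ p ∂ν) ^ (1 / p) * (∫⁻ y, G y ^ q ∂ν) ^ (1 / q)) := by
  have hp0 : 0 < p := by linarith
  have hq0 : 0 < q := by linarith
  obtain ⟨C, hC⟩ := exists_lintegral_lintegral_mul_norm_rpow_le_of_le_one ν hp hq hlam hpq
  refine ⟨C, fun F G hF hG hFt hGt hFp hGq => ?_⟩
  have hvanish : ∀ {H : E → ℝ≥0∞} {r : ℝ}, Measurable H → 0 < r → ∫⁻ x, H x ^ r ∂ν = 0 →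
      ∀ᵐ x ∂ν, H x = 0 := by
    intro H r hH hr h
    rw [lintegral_eq_zero_iff (hH.pow_const r)] at h
    filter_upwards [h] with x hx
    simpa [hr, hr.not_gt] using hx
  rcases eq_or_ne (∫⁻ x, F x ^ p ∂ν) 0 with hF0 | hF0
  · refine (le_of_eq ?_).trans zero_le
    rw [lintegral_congr_ae (g := fun _ => 0), lintegral_zero]
    filter_upwards [hvanish hF hp0 hF0] with x hx
    simp [hx]
  rcases eq_or_ne (∫⁻ y, G y ^ q ∂ν) 0 with hG0 | hG0
  · refine (le_of_eq ?_).trans zero_le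
    rw [lintegral_congr (g := fun _ => 0), lintegral_zero]
    intro x
    rw [lintegral_congr_ae (g := fun _ => 0), lintegral_zero]
    filter_upwards [hvanish hG hq0 hG0] with y hy
    simp [hy]
  have hnorm : ∀ {H : E → ℝ≥0∞} {r : ℝ}, 0 < r → ∫⁻ x, H x ^ r ∂ν ≠ 0 → ∫⁻ x, H x ^ r ∂ν ≠ ∞ →
      ∫⁻ x, (H x / (∫⁻ x, H x ^ r ∂ν) ^ (1 / r)) ^ r ∂ν ≤ 1 := by
    intro H r hr h0 ht
    simp_rw [ENNReal.div_rpow_of_nonneg _ _ hr.le, ← ENNReal.rpow_mul, one_div,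
      inv_mul_cancel₀ hr.ne', ENNReal.rpow_one, div_eq_mul_inv]
    rw [lintegral_mul_const' _ _ (ENNReal.inv_ne_top.2 h0), ENNReal.mul_inv_cancel h0 ht]
  set a := (∫⁻ x, F x ^ p ∂ν) ^ (1 / p)
  set b := (∫⁻ y, G y ^ q ∂ν) ^ (1 / q)
  have ha0 : a ≠ 0 := (ENNReal.rpow_pos (pos_iff_ne_zero.2 hF0) hFp).ne'
  have hb0 : b ≠ 0 := (ENNReal.rpow_pos (pos_iff_ne_zero.2 hG0) hGq).ne'
  have hat : a ≠ ∞ := ENNReal.rpow_ne_top_of_nonneg (by positivity) hFp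
  have hbt : b ≠ ∞ := ENNReal.rpow_ne_top_of_nonneg (by positivity) hGq
  have key := hC (fun x => F x / a) (fun y => G y / b) (hF.div_const a) (hG.div_const b)
    (fun x => ENNReal.div_ne_top (hFt x) ha0) (fun y => ENNReal.div_ne_top (hGt y) hb0)
    (hnorm hp0 hF0 hFp) (hnorm hq0 hG0 hGq)
  have hscale : ∀ x y, F x * G y * ENNReal.ofReal (‖x - y‖ ^ (-lam)) =
      a * b * (F x / a * (G y / b) * ENNReal.ofReal (‖x - y‖ ^ (-lam))) := by
    intro x y
    conv_lhs => rw [← ENNReal.mul_div_cancel ha0 hat (b := F x),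
      ← ENNReal.mul_div_cancel hb0 hbt (b := G y)]
    ring
  have habt : a * b ≠ ∞ := ENNReal.mul_ne_top hat hbt
  simp_rw [hscale, lintegral_const_mul' _ _ habt]
  rw [mul_comm (C : ℝ≥0∞)]
  gcongr

end RieszKernel

lemma le_sup2 {f : RN N → RN N → ℝ} (hf : BddAbove {t | ∃ x y, f x y = t}) (x y : RN N) :
    f x y ≤ sup2 f :=
  le_csSup hf ⟨x, y, rfl⟩

lemma inf2_le {f : RN N → RN N → ℝ} (hf : 0 < inf2 f) (x y : RN N) : inf2 f ≤ f x y := by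
  refine csInf_le ?_ ⟨x, y, rfl⟩
  by_contra h
  exact hf.ne' (Real.sInf_of_not_bddBelow h)

lemma MemCLp.lintegral_ne_top {t : ℝ} {h : RN N → ℝ} (hh : MemCLp univ t h) :
    ∫⁻ x, ENNReal.ofReal |h x| ^ t ≠ ∞ := by
  simpa using hh.2.ne

lemma ofReal_cLpNorm {t : ℝ} (ht : 0 < t) {h : RN N → ℝ} (hh : MemCLp univ t h) :
    ENNReal.ofReal (cLpNorm univ t h) = (∫⁻ x, ENNReal.ofReal |h x| ^ t) ^ (1 / t) := by
  rw [cLpNorm, Measure.restrict_univ,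
    ← ENNReal.ofReal_rpow_of_nonneg ENNReal.toReal_nonneg (by positivity),
    ENNReal.ofReal_toReal hh.lintegral_ne_top]

lemma cLpNorm_nonneg (t : ℝ) (h : RN N → ℝ) : 0 ≤ cLpNorm univ t h :=
  Real.rpow_nonneg ENNReal.toReal_nonneg _

/-- Constant-exponent Hardy–Littlewood–Sobolev inequality in terms of `cLpNorm`. -/
lemma exists_lintegral_prod_mul_dist_rpow_le (hN : 0 < N) {p q lam : ℝ} (hp : 1 < p) (hq : 1 < q)
    (hlam : lam < N) (hpq : 1 / p + 1 / q + lam / N = 2) :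
    ∃ C : NNReal, ∀ h g : RN N → ℝ, MemCLp univ p h → MemCLp univ q g →
      ∫⁻ z : RN N × RN N, ENNReal.ofReal |h z.1| * ENNReal.ofReal |g z.2| *
          ENNReal.ofReal (dist z.1 z.2 ^ (-lam)) ≤
        ENNReal.ofReal (C * (cLpNorm univ p h * cLpNorm univ q g)) := by
  have : Nonempty (Fin N) := ⟨⟨0, hN⟩⟩
  have : Nontrivial (RN N) := inferInstance
  obtain ⟨C, hC⟩ := exists_lintegral_lintegral_mul_norm_rpow_le (volume : Measure (RN N)) hp hq
    (lam := lam) (by simpa using hlam) (by simpa using hpq)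
  refine ⟨C, fun h g hh hg => ?_⟩
  have hF : Measurable fun x => ENNReal.ofReal |h x| :=
    (continuous_abs.measurable.comp hh.1).ennreal_ofReal
  have hG : Measurable fun x => ENNReal.ofReal |g x| :=
    (continuous_abs.measurable.comp hg.1).ennreal_ofReal
  have hm : Measurable fun z : RN N × RN N => ENNReal.ofReal |h z.1| * ENNReal.ofReal |g z.2| *
      ENNReal.ofReal (dist z.1 z.2 ^ (-lam)) :=
    ((hF.comp measurable_fst).mul (hG.comp measurable_snd)).mul
      ((measurable_dist.pow_const _).ennreal_ofReal)
  rw [Measure.volume_eq_prod, lintegral_prod _ hm.aemeasurable,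
    ENNReal.ofReal_mul C.coe_nonneg, ENNReal.ofReal_mul (cLpNorm_nonneg _ _),
    ofReal_cLpNorm (by linarith) hh, ofReal_cLpNorm (by linarith) hg, ENNReal.ofReal_coe_nnreal]
  simp_rw [dist_eq_norm]
  exact hC _ _ hF hG (fun _ => ENNReal.ofReal_ne_top) (fun _ => ENNReal.ofReal_ne_top)
    hh.lintegral_ne_top hg.lintegral_ne_top

lemma rpow_neg_le_add_of_mem_Icc {r a b c : ℝ} (hr : 0 ≤ r) (ha : 0 < a) (hac : a ≤ c)
    (hcb : c ≤ b) : r ^ (-c) ≤ r ^ (-b) + r ^ (-a) := by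
  rcases hr.eq_or_lt with rfl | hr
  · rw [Real.zero_rpow (by linarith), Real.zero_rpow (by linarith), Real.zero_rpow (by linarith)]
    simp
  rcases le_total r 1 with h | h
  · exact le_add_of_le_of_nonneg (Real.rpow_le_rpow_of_exponent_ge hr h (by linarith))
      (Real.rpow_nonneg hr.le _)
  · exact le_add_of_nonneg_of_le (Real.rpow_nonneg hr.le _)
      (Real.rpow_le_rpow_of_exponent_le h (by linarith))

/-- Hardy–Littlewood–Sobolev-type inequality for variable exponents
(Proposition 4.1). -/
theorem statement9 {N : ℕ} (p q μ : RN N → RN N → ℝ)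
    (hp : CPlus2 p) (hq : CPlus2 q)
    (hμb : BddAbove {t | ∃ x y, μ x y = t}) (hμ0 : 0 < inf2 μ)
    (hμN : sup2 μ < N)
    (hrel : ∀ x y, μ x y = 2 * N * (1 - 1 / (2 * p x y) - 1 / (2 * q x y)))
    (x y : ℕ → RN N)
    (hpx : Tendsto (fun n => p (x n) (y n)) atTop (nhds (sup2 p)))
    (hqx : Tendsto (fun n => q (x n) (y n)) atTop (nhds (sup2 q)))
    (x' y' : ℕ → RN N)
    (hpx' : Tendsto (fun n => p (x' n) (y' n)) atTop (nhds (inf2 p)))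
    (hqx' : Tendsto (fun n => q (x' n) (y' n)) atTop (nhds (inf2 q))) :
    ∃ c₁ : ℝ, 0 < c₁ ∧ ∀ h g : RN N → ℝ,
      MemCLp univ (sup2 p) h → MemCLp univ (inf2 p) h →
      MemCLp univ (sup2 q) g → MemCLp univ (inf2 q) g →
      |∫ z : RN N × RN N, h z.1 * g z.2 / dist z.1 z.2 ^ μ z.1 z.2| ≤
        c₁ * (cLpNorm univ (sup2 p) h * cLpNorm univ (sup2 q) g +
          cLpNorm univ (inf2 p) h * cLpNorm univ (inf2 q) g) := by
  have hp1 : 1 < inf2 p := hp.2.1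
  have hq1 : 1 < inf2 q := hq.2.1
  have hpi : ∀ x y, inf2 p ≤ p x y := inf2_le (by linarith)
  have hqi : ∀ x y, inf2 q ≤ q x y := inf2_le (by linarith)
  have hps : ∀ x y, p x y ≤ sup2 p := le_sup2 hp.2.2
  have hqs : ∀ x y, q x y ≤ sup2 q := le_sup2 hq.2.2
  have hp2 : 1 < sup2 p := hp1.trans_le ((hpi 0 0).trans (hps 0 0))
  have hq2 : 1 < sup2 q := hq1.trans_le ((hqi 0 0).trans (hqs 0 0))
  have hμi : ∀ x y, inf2 μ ≤ μ x y := inf2_le hμ0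
  have hμs : ∀ x y, μ x y ≤ sup2 μ := le_sup2 hμb
  have hN' : (0 : ℝ) < N := hμ0.trans_le (((hμi 0 0).trans (hμs 0 0)).trans hμN.le)
  have hN : 0 < N := by exact_mod_cast hN'
  let c : ℝ → ℝ → ℝ := fun a b => 2 * N * (1 - 1 / (2 * a) - 1 / (2 * b))
  have hcmono : ∀ {a a' b b' : ℝ}, 0 < a → a ≤ a' → 0 < b → b ≤ b' → c a b ≤ c a' b' := by
    intro a a' b b' ha haa hb hbb
    unfold c
    gcongr
  have hclim : ∀ {u v : ℕ → RN N} {a b : ℝ}, 1 < a → 1 < b →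
      Tendsto (fun n => p (u n) (v n)) atTop (nhds a) →
      Tendsto (fun n => q (u n) (v n)) atTop (nhds b) →
      Tendsto (fun n => μ (u n) (v n)) atTop (nhds (c a b)) := by
    intro u v a b ha hb h1 h2
    simp_rw [hrel]
    have ha0 : 2 * a ≠ 0 := by linarith
    have hb0 : 2 * b ≠ 0 := by linarith
    exact (((tendsto_const_nhds (x := (1 : ℝ))).sub
      (tendsto_const_nhds.div (h1.const_mul 2) ha0)).sub
      (tendsto_const_nhds.div (h2.const_mul 2) hb0)).const_mul _
  have hc_lt : c (sup2 p) (sup2 q) < N :=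
    (le_of_tendsto' (hclim hp2 hq2 hpx hqx) fun n => hμs _ _).trans_lt hμN
  have hc_pos : 0 < c (inf2 p) (inf2 q) :=
    hμ0.trans_le (ge_of_tendsto' (hclim hp1 hq1 hpx' hqx') fun n => hμi _ _)
  have hμ_le : ∀ x y, μ x y ≤ c (sup2 p) (sup2 q) := fun x y => by
    rw [hrel]
    exact hcmono (by linarith [hpi x y]) (hps x y) (by linarith [hqi x y]) (hqs x y)
  have hμ_ge : ∀ x y, c (inf2 p) (inf2 q) ≤ μ x y := fun x y => by
    rw [hrel]
    exact hcmono (by linarith) (hpi x y) (by linarith) (hqi x y)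
  have hcrit : ∀ {a b : ℝ}, 1 < a → 1 < b → 1 / a + 1 / b + c a b / N = 2 := by
    intro a b ha hb
    have ha0 : a ≠ 0 := by linarith
    have hb0 : b ≠ 0 := by linarith
    unfold c
    field_simp
    ring
  obtain ⟨C₁, hC₁⟩ := exists_lintegral_prod_mul_dist_rpow_le hN hp2 hq2 hc_lt (hcrit hp2 hq2)
  obtain ⟨C₂, hC₂⟩ := exists_lintegral_prod_mul_dist_rpow_le hN hp1 hq1
    (((hμ_ge 0 0).trans (hμ_le 0 0)).trans_lt hc_lt) (hcrit hp1 hq1)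
  refine ⟨C₁ + C₂ + 1, by positivity, fun h g hhs hhi hgs hgi => ?_⟩
  set A := cLpNorm univ (sup2 p) h * cLpNorm univ (sup2 q) g
  set B := cLpNorm univ (inf2 p) h * cLpNorm univ (inf2 q) g
  have hA : 0 ≤ A := mul_nonneg (cLpNorm_nonneg _ _) (cLpNorm_nonneg _ _)
  have hB : 0 ≤ B := mul_nonneg (cLpNorm_nonneg _ _) (cLpNorm_nonneg _ _)
  have hpt : ∀ z : RN N × RN N, ‖h z.1 * g z.2 / dist z.1 z.2 ^ μ z.1 z.2‖ₑ ≤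
      ENNReal.ofReal |h z.1| * ENNReal.ofReal |g z.2| *
          ENNReal.ofReal (dist z.1 z.2 ^ (-c (sup2 p) (sup2 q))) +
        ENNReal.ofReal |h z.1| * ENNReal.ofReal |g z.2| *
          ENNReal.ofReal (dist z.1 z.2 ^ (-c (inf2 p) (inf2 q))) := by
    intro z
    rw [← mul_add, ← ENNReal.ofReal_add (Real.rpow_nonneg dist_nonneg _)
      (Real.rpow_nonneg dist_nonneg _), div_eq_mul_inv, ← Real.rpow_neg dist_nonneg, enorm_mul,
      enorm_mul, Real.enorm_eq_ofReal_abs, Real.enorm_eq_ofReal_abs,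
      Real.enorm_of_nonneg (Real.rpow_nonneg dist_nonneg _)]
    gcongr
    exact rpow_neg_le_add_of_mem_Icc dist_nonneg hc_pos (hμ_ge _ _) (hμ_le _ _)
  have hm : Measurable fun z : RN N × RN N => ENNReal.ofReal |h z.1| * ENNReal.ofReal |g z.2| *
      ENNReal.ofReal (dist z.1 z.2 ^ (-c (sup2 p) (sup2 q))) :=
    (((continuous_abs.measurable.comp (hhs.1.comp measurable_fst)).ennreal_ofReal).mul
      ((continuous_abs.measurable.comp (hgs.1.comp measurable_snd)).ennreal_ofReal)).mul
      ((measurable_dist.pow_const _).ennreal_ofReal)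
  have hle : ‖∫ z : RN N × RN N, h z.1 * g z.2 / dist z.1 z.2 ^ μ z.1 z.2‖ₑ ≤
      ENNReal.ofReal (C₁ * A + C₂ * B) := by
    rw [ENNReal.ofReal_add (by positivity) (by positivity)]
    refine (enorm_integral_le_lintegral_enorm _).trans ((lintegral_mono hpt).trans ?_)
    rw [lintegral_add_left hm]
    exact add_le_add (hC₁ h g hhs hgs) (hC₂ h g hhi hgi)
  rw [Real.enorm_eq_ofReal_abs, ENNReal.ofReal_le_ofReal_iff (by positivity)] at hle
  have h1 : 0 ≤ (C₁ : ℝ) * B := by positivity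
  have h2 : 0 ≤ (C₂ : ℝ) * A := by positivity
  linarith

end VarOrderChoquard
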